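/- arXiv:2602.20971 — 4 statements merged into one kernel-verified Lean document; each statement's English description precedes it below -/
import Mathlib

section
/- Fix n ≥ 1, let A ⊆ ℝ^n be nonempty and bounded, and for each i ∈ {1,…,n} let φ_i : ℝ → ℝ be L_i-Lipschitz with φ_i(0) = 0. Define φ(A) = {(φ_1(a_1),…,φ_n(a_n)) : a ∈ A}. Then Rad(φ(A)) ≤ E_σ[ sup_{a ∈ A} (1/n) ∑_{i=1}^n σ_i L_i a_i ]. In particular, if L_i ≤ L for all i, then Rad(φ(A)) ≤ L · Rad(A). -/
/-- Empirical Rademacher complexity of a set of vectors `A ⊆ ℝⁿ`: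
the expectation, over i.i.d. uniform signs σ ∈ {−1,+1}ⁿ, of
`sup_{a ∈ A} (1/n) ∑ i, σ i * a i`. -/
noncomputable def rad {n : ℕ} (A : Set (Fin n → ℝ)) : ℝ :=
  ((2 : ℝ) ^ n)⁻¹ * ∑ σ : Fin n → Bool,
    sSup ((fun a : Fin n → ℝ =>
      (n : ℝ)⁻¹ * ∑ i, (if σ i then (1 : ℝ) else -1) * a i) '' A)

/-- One-coordinate comparison behind the contraction lemma. -/
theorem iSup_add_add_iSup_sub_le {T : Type*} [Nonempty T] {v f g : T → ℝ}
    (hv : ∃ C, ∀ t, |v t| ≤ C) (hg : ∃ C, ∀ t, |g t| ≤ C)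
    (hfg : ∀ s t, |f s - f t| ≤ |g s - g t|) :
    (⨆ t, (v t + f t)) + ⨆ t, (v t - f t) ≤ (⨆ t, (v t + g t)) + ⨆ t, (v t - g t) := by
  obtain ⟨C, hC⟩ := hv
  obtain ⟨D, hD⟩ := hg
  have hadd : BddAbove (Set.range fun t => v t + g t) :=
    ⟨C + D, by rintro _ ⟨t, rfl⟩; exact add_le_add (le_of_abs_le (hC t)) (le_of_abs_le (hD t))⟩
  have hsub : BddAbove (Set.range fun t => v t - g t) :=
    ⟨C + D, by
      rintro _ ⟨t, rfl⟩
      linarith [le_of_abs_le (hC t), neg_le_of_abs_le (hD t)]⟩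
  rw [← le_sub_iff_add_le]
  refine ciSup_le fun s => ?_
  rw [le_sub_comm]
  refine ciSup_le fun t => ?_
  have hst := (le_abs_self _).trans (hfg s t)
  rcases abs_cases (g s - g t) with ⟨h, -⟩ | ⟨h, -⟩
  · linarith [le_ciSup hadd s, le_ciSup hsub t]
  · linarith [le_ciSup hadd t, le_ciSup hsub s]

/-- Contraction for sign averages of suprema of bounded families, with an offset `u`. -/
theorem sum_iSup_sign_le {T : Type*} [Nonempty T] {n : ℕ} (f g : Fin n → T → ℝ) (u : T → ℝ)
    (hu : ∃ C, ∀ t, |u t| ≤ C) (hf : ∀ i, ∃ C, ∀ t, |f i t| ≤ C)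
    (hg : ∀ i, ∃ C, ∀ t, |g i t| ≤ C) (hfg : ∀ i s t, |f i s - f i t| ≤ |g i s - g i t|) :
    ∑ σ : Fin n → Bool, ⨆ t, (u t + ∑ i, (if σ i then (1 : ℝ) else -1) * f i t) ≤
      ∑ σ : Fin n → Bool, ⨆ t, (u t + ∑ i, (if σ i then (1 : ℝ) else -1) * g i t) := by
  induction n generalizing u with
  | zero => simp
  | succ n ih =>
    have split (h : Fin (n + 1) → T → ℝ) :
        ∑ σ : Fin (n + 1) → Bool, ⨆ t, (u t + ∑ i, (if σ i then (1 : ℝ) else -1) * h i t) =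
          (∑ σ : Fin n → Bool,
            ⨆ t, ((u t + h 0 t) + ∑ i, (if σ i then (1 : ℝ) else -1) * h i.succ t)) +
          ∑ σ : Fin n → Bool,
            ⨆ t, ((u t - h 0 t) + ∑ i, (if σ i then (1 : ℝ) else -1) * h i.succ t) := by
      rw [← (Fin.consEquiv fun _ => Bool).sum_comp, Fintype.sum_prod_type]
      simp [Fin.consEquiv, Fin.sum_univ_succ, ← add_assoc, sub_eq_add_neg]
    obtain ⟨C, hC⟩ := hu
    obtain ⟨D, hD⟩ := hf 0
    have ih' := fun w hw => ih (fun i => f i.succ) (fun i => g i.succ) w hw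
      (fun i => hf i.succ) (fun i => hg i.succ) (fun i => hfg i.succ)
    rw [split f, split g]
    refine (add_le_add
      (ih' (fun t => u t + f 0 t)
        ⟨C + D, fun t => (abs_add_le _ _).trans (add_le_add (hC t) (hD t))⟩)
      (ih' (fun t => u t - f 0 t)
        ⟨C + D, fun t => (abs_sub _ _).trans (add_le_add (hC t) (hD t))⟩)).trans ?_
    rw [← Finset.sum_add_distrib, ← Finset.sum_add_distrib]
    refine Finset.sum_le_sum fun σ _ => ?_
    choose G hG using hg
    have hv : ∃ K, ∀ t, |u t + ∑ i, (if σ i then (1 : ℝ) else -1) * g i.succ t| ≤ K := by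
      refine ⟨C + ∑ i : Fin n, G i.succ, fun t => (abs_add_le _ _).trans (add_le_add (hC t) ?_)⟩
      refine (Finset.abs_sum_le_sum_abs _ _).trans (Finset.sum_le_sum fun i _ => ?_)
      refine le_trans (le_of_eq ?_) (hG i.succ t)
      split_ifs <;> simp
    simpa only [add_right_comm, sub_add_eq_add_sub] using
      iSup_add_add_iSup_sub_le hv ⟨G 0, hG 0⟩ (hfg 0)

/-- Rademacher contraction lemma. If each `φ i` is `L i`-Lipschitz
with `φ i 0 = 0`, then `Rad(φ(A)) ≤ E_σ[sup_{a∈A} (1/n) ∑ i, σ i * L i * a i]`;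
in particular, if `L i ≤ L₀` for all `i`, then `Rad(φ(A)) ≤ L₀ * Rad(A)`. -/
theorem rad_contraction
    {n : ℕ} (hn : 1 ≤ n) (A : Set (Fin n → ℝ))
    (hA : A.Nonempty) (hAbdd : Bornology.IsBounded A)
    (φ : Fin n → ℝ → ℝ) (L : Fin n → ℝ)
    (hφ : ∀ i, ∀ u v : ℝ, |φ i u - φ i v| ≤ L i * |u - v|)
    (hφ0 : ∀ i, φ i 0 = 0) :
    rad ((fun a : Fin n → ℝ => fun i => φ i (a i)) '' A)
        ≤ ((2 : ℝ) ^ n)⁻¹ * ∑ σ : Fin n → Bool,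
          sSup ((fun a : Fin n → ℝ =>
            (n : ℝ)⁻¹ * ∑ i, (if σ i then (1 : ℝ) else -1) * (L i * a i)) '' A) ∧
      ∀ L₀ : ℝ, (∀ i, L i ≤ L₀) →
        rad ((fun a : Fin n → ℝ => fun i => φ i (a i)) '' A) ≤ L₀ * rad A := by
  have hL (i : Fin n) : 0 ≤ L i := by simpa using (abs_nonneg _).trans (hφ i 1 0)
  have key (M : Fin n → ℝ) (hM : ∀ i, L i ≤ M i) :
      rad ((fun a : Fin n → ℝ => fun i => φ i (a i)) '' A)
        ≤ ((2 : ℝ) ^ n)⁻¹ * ∑ σ : Fin n → Bool,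
          sSup ((fun a : Fin n → ℝ =>
            (n : ℝ)⁻¹ * ∑ i, (if σ i then (1 : ℝ) else -1) * (M i * a i)) '' A) := by
    have hM0 (i : Fin n) : 0 ≤ M i := (hL i).trans (hM i)
    have hn0 : (0 : ℝ) ≤ (n : ℝ)⁻¹ := by positivity
    have : Nonempty A := hA.to_subtype
    obtain ⟨R, hR⟩ := hAbdd.exists_norm_le
    have hbdd (i : Fin n) (a : A) : |(a : Fin n → ℝ) i| ≤ R :=
      (norm_le_pi_norm (a : Fin n → ℝ) i).trans (hR a a.2)
    have hlip (i : Fin n) (u v : ℝ) : |φ i u - φ i v| ≤ M i * |u - v| :=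
      (hφ i u v).trans (mul_le_mul_of_nonneg_right (hM i) (abs_nonneg _))
    have hsum := sum_iSup_sign_le
      (fun i (a : A) => (n : ℝ)⁻¹ * φ i ((a : Fin n → ℝ) i))
      (fun i (a : A) => (n : ℝ)⁻¹ * (M i * (a : Fin n → ℝ) i)) (fun _ => 0)
      ⟨0, by simp⟩
      (fun i => ⟨(n : ℝ)⁻¹ * (M i * R), fun a => by
        rw [abs_mul, abs_of_nonneg hn0]
        have := hlip i ((a : Fin n → ℝ) i) 0
        rw [hφ0, sub_zero, sub_zero] at this
        exact mul_le_mul_of_nonneg_left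
          (this.trans (mul_le_mul_of_nonneg_left (hbdd i a) (hM0 i))) hn0⟩)
      (fun i => ⟨(n : ℝ)⁻¹ * (M i * R), fun a => by
        rw [abs_mul, abs_mul, abs_of_nonneg hn0, abs_of_nonneg (hM0 i)]
        exact mul_le_mul_of_nonneg_left (mul_le_mul_of_nonneg_left (hbdd i a) (hM0 i)) hn0⟩)
      (fun i s t => by
        rw [← mul_sub, ← mul_sub, ← mul_sub, abs_mul, abs_mul, abs_mul, abs_of_nonneg (hM0 i)]
        exact mul_le_mul_of_nonneg_left (hlip i _ _) (abs_nonneg _))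
    refine mul_le_mul_of_nonneg_left ?_ (by positivity)
    simpa only [Set.image_image, sSup_image', Finset.mul_sum, mul_left_comm, zero_add] using hsum
  refine ⟨key L fun _ => le_rfl, fun L₀ hL₀ => (key (fun _ => L₀) hL₀).trans_eq ?_⟩
  have hL₀0 : 0 ≤ L₀ := (hL ⟨0, hn⟩).trans (hL₀ _)
  simp only [rad, sSup_image', mul_left_comm _ L₀, ← Finset.mul_sum, ← Real.mul_iSup_of_nonneg hL₀0]
end

section
/- Fix n ≥ 1 and let A ⊆ ℝ^n be nonempty and bounded. Let |A| = {(|a_1|,…,|a_n|) : a ∈ A}. Then Rad(|A|) ≤ Rad(A). -/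
theorem Bornology.IsBounded.image_of_continuous {X Y : Type*} [PseudoMetricSpace X] [ProperSpace X]
    [PseudoMetricSpace Y] {A : Set X} (hA : Bornology.IsBounded A) {f : X → Y}
    (hf : Continuous f) : Bornology.IsBounded (f '' A) :=
  (hA.isCompact_closure.image hf).isBounded.subset (Set.image_mono subset_closure)

/-- If a map `T` is dominated, for each pair of points, by one of the two ways of assigning the
points to `f` and `g`, then it does not increase the sum of the suprema of `f` and `g`. -/
theorem csSup_image_add_csSup_image_le {X : Type*} {A : Set X} (hA : A.Nonempty) {f g : X → ℝ}
    (hf : BddAbove (f '' A)) (hg : BddAbove (g '' A)) {T : X → X}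
    (h : ∀ a b, f (T a) + g (T b) ≤ f a + g b ∨ f (T a) + g (T b) ≤ f b + g a) :
    sSup (f '' (T '' A)) + sSup (g '' (T '' A)) ≤ sSup (f '' A) + sSup (g '' A) := by
  have key : ∀ a ∈ A, ∀ b ∈ A, f (T a) + g (T b) ≤ sSup (f '' A) + sSup (g '' A) := by
    intro a ha b hb
    have hfa := le_csSup hf (Set.mem_image_of_mem f ha)
    have hfb := le_csSup hf (Set.mem_image_of_mem f hb)
    have hga := le_csSup hg (Set.mem_image_of_mem g ha)
    have hgb := le_csSup hg (Set.mem_image_of_mem g hb)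
    rcases h a b with h | h <;> linarith
  rw [← le_sub_iff_add_le]
  refine csSup_le ((hA.image T).image f) ?_
  rintro _ ⟨_, ⟨a, ha, rfl⟩, rfl⟩
  rw [le_sub_comm]
  refine csSup_le ((hA.image T).image g) ?_
  rintro _ ⟨_, ⟨b, hb, rfl⟩, rfl⟩
  linarith [key a ha b hb]

/-- Replacing a single coordinate by its absolute value does not increase the Rademacher
complexity. -/
theorem rad_image_update_abs_le {n : ℕ} (j : Fin n) {A : Set (Fin n → ℝ)}
    (hA : A.Nonempty) (hAbdd : Bornology.IsBounded A) :
    rad ((fun a : Fin n → ℝ => Function.update a j |a j|) '' A) ≤ rad A := by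
  unfold rad
  refine mul_le_mul_of_nonneg_left ?_ (by positivity)
  have flip_inv : Function.Involutive
      (fun σ : Fin n → Bool => Function.update σ j (!σ j)) := by
    intro σ
    simp
  have sum_flip (F : (Fin n → Bool) → ℝ) :
      ∑ σ, (F σ + F (Function.update σ j (!σ j))) = 2 * ∑ σ, F σ := by
    rw [Finset.sum_add_distrib, two_mul]
    congr 1
    exact Equiv.sum_comp flip_inv.toPerm F
  refine le_of_mul_le_mul_left ?_ (two_pos (α := ℝ))
  rw [← sum_flip, ← sum_flip]
  refine Finset.sum_le_sum fun σ _ => ?_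
  have bdd (τ : Fin n → Bool) : BddAbove ((fun a : Fin n → ℝ =>
      (n : ℝ)⁻¹ * ∑ i, (if τ i then (1 : ℝ) else -1) * a i) '' A) :=
    (hAbdd.image_of_continuous (by fun_prop)).bddAbove
  refine csSup_image_add_csSup_image_le hA (bdd _) (bdd _) fun a b => ?_
  have split (τ : Fin n → Bool) (c : Fin n → ℝ) :
      ∑ i, (if τ i then (1 : ℝ) else -1) * c i = (if τ j then (1 : ℝ) else -1) * c j +
        ∑ i ∈ Finset.univ.erase j, (if τ i then (1 : ℝ) else -1) * c i :=
    (Finset.add_sum_erase _ _ (Finset.mem_univ j)).symm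
  have off_flip (c : Fin n → ℝ) : ∑ i ∈ Finset.univ.erase j,
      (if Function.update σ j (!σ j) i then (1 : ℝ) else -1) * c i =
      ∑ i ∈ Finset.univ.erase j, (if σ i then (1 : ℝ) else -1) * c i :=
    Finset.sum_congr rfl fun i hi => by
      rw [Function.update_of_ne (Finset.ne_of_mem_erase hi)]
  have off_abs (c : Fin n → ℝ) : ∑ i ∈ Finset.univ.erase j,
      (if σ i then (1 : ℝ) else -1) * Function.update c j |c j| i =
      ∑ i ∈ Finset.univ.erase j, (if σ i then (1 : ℝ) else -1) * c i :=
    Finset.sum_congr rfl fun i hi => by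
      rw [Function.update_of_ne (Finset.ne_of_mem_erase hi)]
  simp only [← mul_add]
  have hn : (0 : ℝ) ≤ (n : ℝ)⁻¹ := by positivity
  refine Or.imp (mul_le_mul_of_nonneg_left · hn) (mul_le_mul_of_nonneg_left · hn) ?_
  simp only [split, off_flip, off_abs, Function.update_self]
  have hab := abs_sub_abs_le_abs_sub (a j) (b j)
  have hba := abs_sub_abs_le_abs_sub (b j) (a j)
  rw [abs_sub_comm] at hba
  rcases abs_choice (a j - b j) with h | h <;> rw [h] at hab hba <;> cases σ j <;>
    simp only [Bool.not_true, Bool.not_false, if_true, Bool.false_eq_true, if_false]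
  · right; linarith
  · left; linarith
  · left; linarith
  · right; linarith

/-- Replacing the coordinates in `S` by their absolute values does not increase the Rademacher
complexity. -/
theorem rad_image_abs_on_le {n : ℕ} (S : Finset (Fin n)) {A : Set (Fin n → ℝ)}
    (hA : A.Nonempty) (hAbdd : Bornology.IsBounded A) :
    rad ((fun a : Fin n → ℝ => fun i => if i ∈ S then |a i| else a i) '' A) ≤ rad A := by
  induction S using Finset.induction_on with
  | empty => simp
  | insert j S hj ih =>
    have hcont : Continuous (fun a : Fin n → ℝ => fun i => if i ∈ S then |a i| else a i) :=
      continuous_pi fun i => by split_ifs <;> fun_prop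
    refine le_trans (le_of_eq ?_)
      ((rad_image_update_abs_le j (hA.image _) (hAbdd.image_of_continuous hcont)).trans ih)
    rw [Set.image_image]
    congr 2
    ext a i
    by_cases hij : i = j
    · subst hij
      simp [hj]
    · simp [hij]

/-- absolute value contraction, `Rad(|A|) ≤ Rad(A)`. -/
theorem rad_abs_contraction
    {n : ℕ} (hn : 1 ≤ n) (A : Set (Fin n → ℝ))
    (hA : A.Nonempty) (hAbdd : Bornology.IsBounded A) :
    rad ((fun a : Fin n → ℝ => fun i => |a i|) '' A) ≤ rad A := by
  simpa using rad_image_abs_on_le Finset.univ hA hAbdd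
end

section
/- Fix n ≥ 1 and let A, B ⊆ ℝ^n be nonempty and bounded. Define the coordinatewise maximum A ∨ B = {a ∨ b : a ∈ A, b ∈ B}, where (a ∨ b)_i = max{a_i, b_i}. Then Rad(A ∨ B) ≤ Rad(A) + Rad(B). -/
/-- The signed sum `∑ i, σ i * a i`, with `true` read as `1` and `false` as `-1`. -/
def signedSum {n : ℕ} (σ : Fin n → Bool) (a : Fin n → ℝ) : ℝ :=
  ∑ i, (if σ i then (1 : ℝ) else -1) * a i

theorem abs_signedSum_le {n : ℕ} (σ : Fin n → Bool) {a : Fin n → ℝ} {M : ℝ}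
    (h : ∀ i, |a i| ≤ M) : |signedSum σ a| ≤ n * M := by
  calc |signedSum σ a| ≤ ∑ i, |(if σ i then (1 : ℝ) else -1) * a i| :=
        Finset.abs_sum_le_sum_abs _ _
    _ ≤ ∑ _i : Fin n, M := by
        refine Finset.sum_le_sum fun i _ => ?_
        have := h i
        split_ifs <;> simpa using this
    _ = n * M := by simp

theorem bddAbove_range_signedSum {ι : Type*} {n : ℕ} (σ : Fin n → Bool) {u : ι → Fin n → ℝ}
    {M : ℝ} (h : ∀ t i, |u t i| ≤ M) : BddAbove (Set.range fun t => signedSum σ (u t)) := by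
  refine ⟨n * M, ?_⟩
  rintro _ ⟨t, rfl⟩
  exact (le_abs_self _).trans (abs_signedSum_le σ (h t))

theorem signedSum_cons {n : ℕ} (b : Bool) (σ : Fin n → Bool) (a : Fin (n + 1) → ℝ) :
    signedSum (Fin.cons b σ : Fin (n + 1) → Bool) a =
      (if b then (1 : ℝ) else -1) * a 0 + signedSum σ (fun i => a i.succ) := by
  simp [signedSum, Fin.sum_univ_succ]

theorem signedSum_not {n : ℕ} (σ : Fin n → Bool) (a : Fin n → ℝ) :
    signedSum (fun i => !σ i) a = -signedSum σ a := by
  rw [signedSum, signedSum, ← Finset.sum_neg_distrib]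
  refine Finset.sum_congr rfl fun i _ => ?_
  cases σ i <;> simp

theorem sum_cons_bool {n : ℕ} (f : (Fin (n + 1) → Bool) → ℝ) :
    ∑ σ, f σ = ∑ σ : Fin n → Bool, f (Fin.cons true σ) +
      ∑ σ : Fin n → Bool, f (Fin.cons false σ) := by
  rw [← (Fin.consEquiv fun _ : Fin (n + 1) => Bool).sum_comp, Fintype.sum_prod_type]
  simp [Fin.consEquiv]

/-- The one-coordinate case of the contraction principle. -/
theorem ciSup_add_ciSup_le_of_abs_sub_le {ι : Type*} [Nonempty ι] {g u v : ι → ℝ}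
    (huv : ∀ s t, |u s - u t| ≤ |v s - v t|)
    (hadd : BddAbove (Set.range fun t => g t + v t))
    (hsub : BddAbove (Set.range fun t => g t - v t)) :
    (⨆ t, (g t + u t)) + (⨆ t, (g t - u t)) ≤ (⨆ t, (g t + v t)) + ⨆ t, (g t - v t) := by
  refine ciSup_add_ciSup_le fun s t => ?_
  have h := (le_abs_self _).trans (huv s t)
  have h₁ := le_ciSup hadd s
  have h₂ := le_ciSup hadd t
  have h₃ := le_ciSup hsub s
  have h₄ := le_ciSup hsub t
  rcases abs_cases (v s - v t) with ⟨h', _⟩ | ⟨h', _⟩ <;> linarith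

/-- The Ledoux–Talagrand contraction principle for Rademacher averages, with an offset `c`. -/
theorem sum_ciSup_signedSum_le_of_abs_sub_le {ι : Type*} [Nonempty ι] {n : ℕ} {c : ι → ℝ}
    {u v : ι → Fin n → ℝ} {K M N : ℝ} (hc : ∀ t, |c t| ≤ K)
    (hu : ∀ t i, |u t i| ≤ M) (hv : ∀ t i, |v t i| ≤ N)
    (huv : ∀ s t i, |u s i - u t i| ≤ |v s i - v t i|) :
    ∑ σ : Fin n → Bool, ⨆ t, (c t + signedSum σ (u t)) ≤
      ∑ σ : Fin n → Bool, ⨆ t, (c t + signedSum σ (v t)) := by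
  induction n generalizing c K with
  | zero => simp [signedSum]
  | succ n ih =>
    have bound (w : ι → ℝ) (hw : ∀ t, |w t| ≤ N) (σ : Fin n → Bool) :
        BddAbove (Set.range fun t => c t + signedSum σ (fun i => v t i.succ) + w t) := by
      refine ⟨K + n * N + N, ?_⟩
      rintro _ ⟨t, rfl⟩
      have h₁ := (le_abs_self _).trans (hc t)
      have h₂ := (le_abs_self _).trans (abs_signedSum_le σ fun i : Fin n => hv t i.succ)
      have h₃ := (le_abs_self _).trans (hw t)
      dsimp only
      linarith
    have ih_true := ih (c := fun t => c t + u t 0) (K := K + M)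
      (fun t => (abs_add_le _ _).trans (add_le_add (hc t) (hu t 0)))
      (fun t i => hu t i.succ) (fun t i => hv t i.succ) (fun s t i => huv s t i.succ)
    have ih_false := ih (c := fun t => c t - u t 0) (K := K + M)
      (fun t => (abs_sub _ _).trans (add_le_add (hc t) (hu t 0)))
      (fun t i => hu t i.succ) (fun t i => hv t i.succ) (fun s t i => huv s t i.succ)
    rw [sum_cons_bool, sum_cons_bool]
    simp only [signedSum_cons, if_true, Bool.false_eq_true, if_false, one_mul, neg_one_mul,
      ← add_assoc, ← sub_eq_add_neg]
    refine (add_le_add ih_true ih_false).trans ?_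
    rw [← Finset.sum_add_distrib, ← Finset.sum_add_distrib]
    refine Finset.sum_le_sum fun σ _ => ?_
    have key := ciSup_add_ciSup_le_of_abs_sub_le
      (g := fun t => c t + signedSum σ (fun i => v t i.succ)) (fun s t => huv s t 0)
      (bound (fun t => v t 0) (fun t => hv t 0) σ)
      (by simpa only [sub_eq_add_neg] using
        bound (fun t => -v t 0) (fun t => by simpa using hv t 0) σ)
    simpa only [add_right_comm, add_sub_right_comm] using key

theorem rad_range {ι : Type*} {n : ℕ} (u : ι → Fin n → ℝ) :
    rad (Set.range u) =
      ((2 : ℝ) ^ n)⁻¹ * ((n : ℝ)⁻¹ * ∑ σ : Fin n → Bool, ⨆ t, signedSum σ (u t)) := by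
  rw [rad, Finset.mul_sum _ _ (n : ℝ)⁻¹]
  refine congrArg _ (Finset.sum_congr rfl fun σ _ => ?_)
  rw [← Set.range_comp, Real.mul_iSup_of_nonneg (by positivity)]
  rfl

theorem exists_abs_le_of_isBounded {n : ℕ} {A : Set (Fin n → ℝ)}
    (hA : Bornology.IsBounded A) : ∃ M, ∀ (a : A) (i : Fin n), |(a : Fin n → ℝ) i| ≤ M := by
  obtain ⟨M, hM⟩ := hA.exists_norm_le
  exact ⟨M, fun a i => (norm_le_pi_norm (a : Fin n → ℝ) i).trans (hM a a.2)⟩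

theorem sum_ciSup_signedSum_max_le {ι κ : Type*} [Nonempty ι] [Nonempty κ] {n : ℕ}
    {u : ι → Fin n → ℝ} {v : κ → Fin n → ℝ} {M N : ℝ}
    (hu : ∀ s i, |u s i| ≤ M) (hv : ∀ t i, |v t i| ≤ N) :
    ∑ σ : Fin n → Bool, ⨆ p : ι × κ, signedSum σ (fun i => max (u p.1 i) (v p.2 i)) ≤
      ∑ σ : Fin n → Bool, (⨆ s, signedSum σ (u s)) +
        ∑ σ : Fin n → Bool, ⨆ t, signedSum σ (v t) := by
  have hsub (p : ι × κ) (i : Fin n) : |u p.1 i - v p.2 i| ≤ M + N :=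
    (abs_sub _ _).trans (add_le_add (hu _ _) (hv _ _))
  have habs (p : ι × κ) (i : Fin n) : |(|u p.1 i - v p.2 i|)| ≤ M + N := by
    simpa using hsub p i
  have hmax (σ : Fin n → Bool) :
      ⨆ p : ι × κ, signedSum σ (fun i => max (u p.1 i) (v p.2 i)) ≤
        ((⨆ s, signedSum σ (u s)) + (⨆ t, signedSum σ (v t)) +
          ⨆ p : ι × κ, signedSum σ (fun i => |u p.1 i - v p.2 i|)) / 2 := by
    refine ciSup_le fun p => ?_
    have h₁ := le_ciSup (bddAbove_range_signedSum σ hu) p.1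
    have h₂ := le_ciSup (bddAbove_range_signedSum σ hv) p.2
    have h₃ := le_ciSup (bddAbove_range_signedSum σ habs) p
    have h : signedSum σ (fun i => max (u p.1 i) (v p.2 i)) =
        (signedSum σ (u p.1) + signedSum σ (v p.2) +
          signedSum σ (fun i => |u p.1 i - v p.2 i|)) / 2 := by
      simp only [signedSum, ← Finset.sum_add_distrib, Finset.sum_div]
      refine Finset.sum_congr rfl fun i _ => ?_
      have := max_add_min (u p.1 i) (v p.2 i)
      have := max_sub_min_eq_abs' (u p.1 i) (v p.2 i)
      split_ifs <;> linarith
    linarith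
  have hdiff (σ : Fin n → Bool) :
      ⨆ p : ι × κ, signedSum σ (fun i => u p.1 i - v p.2 i) ≤
        (⨆ s, signedSum σ (u s)) + ⨆ t, signedSum (fun i => !σ i) (v t) := by
    refine ciSup_le fun p => ?_
    have h₁ := le_ciSup (bddAbove_range_signedSum σ hu) p.1
    have h₂ := le_ciSup (bddAbove_range_signedSum (fun i => !σ i) hv) p.2
    rw [signedSum_not] at h₂
    have h : signedSum σ (fun i => u p.1 i - v p.2 i) =
        signedSum σ (u p.1) - signedSum σ (v p.2) := by
      simp only [signedSum, mul_sub, Finset.sum_sub_distrib]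
    linarith
  have hflip : ∑ σ : Fin n → Bool, ⨆ t, signedSum (fun i => !σ i) (v t) =
      ∑ σ : Fin n → Bool, ⨆ t, signedSum σ (v t) :=
    (Equiv.arrowCongr (Equiv.refl (Fin n)) Equiv.boolNot).sum_comp
      fun σ => ⨆ t, signedSum σ (v t)
  have hcontr := sum_ciSup_signedSum_le_of_abs_sub_le (c := fun _ : ι × κ => 0) (K := 0)
    (by simp) habs hsub (fun p q i => abs_abs_sub_abs_le _ _)
  simp only [zero_add] at hcontr
  have h₁ := Finset.sum_le_sum fun σ (_ : σ ∈ Finset.univ) => hmax σ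
  have h₂ := Finset.sum_le_sum fun σ (_ : σ ∈ Finset.univ) => hdiff σ
  rw [← Finset.sum_div, Finset.sum_add_distrib, Finset.sum_add_distrib] at h₁
  rw [Finset.sum_add_distrib, hflip] at h₂
  linarith

/-- coordinatewise maxima, `Rad(A ∨ B) ≤ Rad(A) + Rad(B)`. -/
theorem rad_coordinatewise_max
    {n : ℕ} (hn : 1 ≤ n) (A B : Set (Fin n → ℝ))
    (hA : A.Nonempty) (hB : B.Nonempty)
    (hAbdd : Bornology.IsBounded A) (hBbdd : Bornology.IsBounded B) :
    rad (Set.image2 (fun a b : Fin n → ℝ => fun i => max (a i) (b i)) A B)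
      ≤ rad A + rad B := by
  have := hA.to_subtype
  have := hB.to_subtype
  obtain ⟨M, hM⟩ := exists_abs_le_of_isBounded hAbdd
  obtain ⟨N, hN⟩ := exists_abs_le_of_isBounded hBbdd
  have hrange : Set.image2 (fun a b : Fin n → ℝ => fun i => max (a i) (b i)) A B =
      Set.range fun p : A × B => fun i => max ((p.1 : Fin n → ℝ) i) ((p.2 : Fin n → ℝ) i) := by
    ext x
    simp [Set.mem_image2]
  have hRA := rad_range (Subtype.val : A → Fin n → ℝ)
  have hRB := rad_range (Subtype.val : B → Fin n → ℝ)
  rw [Subtype.range_coe] at hRA hRB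
  rw [hrange, rad_range, hRA, hRB, ← mul_add, ← mul_add]
  gcongr
  exact sum_ciSup_signedSum_max_le hM hN
end

section
/- Fix n ≥ 1, a nonempty bounded set A ⊆ ℝ^n, functions U : A → ℝ and v : A → ℝ with U bounded and v bounded, and a K-Lipschitz function ψ : ℝ → ℝ. Let ε be a random sign uniform on {−1, +1}. Then E_ε[ sup_{a ∈ A} (U(a) + ε·ψ(v(a))) ] ≤ E_ε[ sup_{a ∈ A} (U(a) + ε·K·v(a)) ]. -/
/-- The sum of two suprema is at most `c` when all sums of pairs of values are. -/
theorem sSup_image_add_sSup_image_le {α : Type*} {A : Set α} (hA : A.Nonempty)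
    {f g : α → ℝ} {c : ℝ} (h : ∀ a ∈ A, ∀ b ∈ A, f a + g b ≤ c) :
    sSup (f '' A) + sSup (g '' A) ≤ c := by
  rw [← le_sub_iff_add_le]
  refine csSup_le (hA.image f) (Set.forall_mem_image.2 fun a ha => ?_)
  rw [le_sub_comm]
  refine csSup_le (hA.image g) (Set.forall_mem_image.2 fun b hb => ?_)
  linarith [h a ha b hb]

/-- A combination `U + s * v` of functions bounded on `A` is bounded above on `A`. -/
theorem bddAbove_image_add_const_mul {α : Type*} {A : Set α} {U v : α → ℝ}
    (hU : ∃ M : ℝ, ∀ a ∈ A, |U a| ≤ M) (hv : ∃ M : ℝ, ∀ a ∈ A, |v a| ≤ M) (s : ℝ) :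
    BddAbove ((fun a => U a + s * v a) '' A) := by
  obtain ⟨M, hM⟩ := hU
  obtain ⟨N, hN⟩ := hv
  refine ⟨M + |s| * N, Set.forall_mem_image.2 fun a ha => ?_⟩
  refine add_le_add ((le_abs_self _).trans (hM a ha)) ((le_abs_self _).trans ?_)
  rw [abs_mul]
  exact mul_le_mul_of_nonneg_left (hN a ha) (abs_nonneg s)


/-- one-step replacement inequality of the Rademacher contraction
lemma. The expectation over a uniform sign ε ∈ {−1,+1} is written out as the
average of the two sign realizations. -/
theorem one_step_replacement
    {n : ℕ} (hn : 1 ≤ n) (A : Set (Fin n → ℝ))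
    (hA : A.Nonempty) (hAbdd : Bornology.IsBounded A)
    (U v : (Fin n → ℝ) → ℝ)
    (hU : ∃ M : ℝ, ∀ a ∈ A, |U a| ≤ M)
    (hv : ∃ M : ℝ, ∀ a ∈ A, |v a| ≤ M)
    (ψ : ℝ → ℝ) (K : ℝ)
    (hψ : ∀ u u' : ℝ, |ψ u - ψ u'| ≤ K * |u - u'|) :
    (2 : ℝ)⁻¹ * (sSup ((fun a => U a + 1 * ψ (v a)) '' A)
        + sSup ((fun a => U a + (-1) * ψ (v a)) '' A))
      ≤ (2 : ℝ)⁻¹ * (sSup ((fun a => U a + 1 * (K * v a)) '' A)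
        + sSup ((fun a => U a + (-1) * (K * v a)) '' A)) := by
  have bdd : ∀ s : ℝ, BddAbove ((fun a => U a + s * (K * v a)) '' A) := fun s => by
    simpa only [mul_assoc] using bddAbove_image_add_const_mul hU hv (s * K)
  have le_sup : ∀ s : ℝ, ∀ a ∈ A,
      U a + s * (K * v a) ≤ sSup ((fun a => U a + s * (K * v a)) '' A) :=
    fun s a ha => le_csSup (bdd s) (Set.mem_image_of_mem _ ha)
  refine mul_le_mul_of_nonneg_left
    (sSup_image_add_sSup_image_le hA fun a ha b hb => ?_) (by norm_num)
  have lip := (le_abs_self _).trans (hψ (v a) (v b))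
  rcases abs_cases (v a - v b) with ⟨h, -⟩ | ⟨h, -⟩ <;> rw [h] at lip
  · linarith [le_sup 1 a ha, le_sup (-1) b hb]
  · linarith [le_sup 1 b hb, le_sup (-1) a ha]
end
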